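/- arXiv:1801.05834 — 2 statements merged into one kernel-verified Lean document; each statement's English description precedes it below -/
import Mathlib

section
/- Let n ≥ 1, k ≥ 0, d ≥ 0, and let P be a homogeneous prime ideal of the graded polynomial ring ℂ[x₀, …, x_n] that does not contain the irrelevant ideal (x₀, …, x_n), and suppose the Krull dimension of the quotient ring ℂ[x₀, …, x_n]/P equals k + 1 (so that P defines an irreducible projective subvariety Z ⊆ ℙⁿ of dimension k). Then the ℂ-linear subspace P_d = P ∩ (degree-d homogeneous component) has codimension at least binom(d+k, k) in the space of all homogeneous polynomials of degree d in x₀, …, x_n. -/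
open MvPolynomial Module

theorem ringKrullDim_le_of_algebra_isIntegral (R S : Type*) [CommRing R] [CommRing S]
    [Algebra R S] [Algebra.IsIntegral R S] : ringKrullDim S ≤ ringKrullDim R := by
  refine Order.krullDim_le_of_strictMono (PrimeSpectrum.comap (algebraMap R S)) fun I J hIJ ↦ ?_
  obtain ⟨hle, x, hxJ, hxI⟩ := SetLike.lt_iff_le_and_exists.mp (show I.asIdeal < J.asIdeal from hIJ)
  exact Ideal.comap_lt_comap_of_integral_mem_sdiff hle ⟨hxJ, hxI⟩ (Algebra.IsIntegral.isIntegral x)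

/-- The Krull dimension of a finitely generated domain over a field is at most its
transcendence degree. -/
theorem ringKrullDim_le_toNat_trdeg (k A : Type*) [Field k] [CommRing A] [IsDomain A]
    [Algebra k A] [Algebra.FiniteType k A] :
    ringKrullDim A ≤ (Cardinal.toNat (Algebra.trdeg k A) : ℕ) := by
  obtain ⟨s, g, hinj, hint⟩ := exists_integral_inj_algHom_of_fg k A
  have hdim : ringKrullDim A ≤ (s : ℕ) := by
    algebraize [g.toRingHom]
    have : Algebra.IsIntegral (MvPolynomial (Fin s) k) A := ⟨hint⟩
    simpa using ringKrullDim_le_of_algebra_isIntegral (MvPolynomial (Fin s) k) A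
  have hs : s ≤ Cardinal.toNat (Algebra.trdeg k A) := by
    have := Cardinal.toNat_le_toNat (lift_trdeg_le_of_injective g hinj)
      (by simpa using trdeg_lt_aleph0_of_finiteType)
    simpa [MvPolynomial.trdeg_of_isDomain] using this
  exact hdim.trans (by exact_mod_cast hs)

/-- A finite family of generators of a domain of Krull dimension at least `m` contains `m`
algebraically independent members. -/
theorem exists_embedding_algebraicIndependent {k A ι : Type*} [Field k] [CommRing A] [IsDomain A]
    [Algebra k A] [Finite ι] (x : ι → A) (hx : Algebra.adjoin k (Set.range x) = ⊤) {m : ℕ}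
    (hm : (m : WithBot ℕ∞) ≤ ringKrullDim A) :
    ∃ e : Fin m ↪ ι, AlgebraicIndependent k (x ∘ e) := by
  have : Algebra.FiniteType k A := ⟨(Set.finite_range x).toFinset, by simpa using hx⟩
  have : Algebra.IsAlgebraic (Algebra.adjoin k (Set.range x)) A :=
    ⟨fun a ↦ isAlgebraic_algebraMap
      (⟨a, hx ▸ Algebra.mem_top⟩ : Algebra.adjoin k (Set.range x))⟩
  obtain ⟨t, htx, ht⟩ := exists_isTranscendenceBasis_subset (R := k) (Set.range x)
  have : Finite t := (Set.finite_range x).subset htx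
  have hcard : m ≤ Nat.card t := by
    have := hm.trans (ringKrullDim_le_toNat_trdeg k A)
    rw [← ht.cardinalMk_eq_trdeg] at this
    exact_mod_cast this
  have := Fintype.ofFinite t
  obtain ⟨f⟩ : Nonempty (Fin m ↪ t) :=
    Function.Embedding.nonempty_of_card_le (by simpa [Nat.card_eq_fintype_card] using hcard)
  choose g hg using fun a : t ↦ htx a.2
  refine ⟨⟨g ∘ f, ?_⟩, ?_⟩
  · intro a b hab
    apply f.injective
    apply Subtype.ext
    rw [← hg, ← hg]
    exact congrArg x hab
  · convert ht.1.comp f f.injective using 1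
    ext i
    exact hg (f i)

theorem finrank_homogeneousSubmodule (σ R : Type*) [Fintype σ] [CommRing R] [Nontrivial R]
    (d : ℕ) : finrank R (homogeneousSubmodule σ R d) = (Fintype.card σ).multichoose d := by
  classical
  have hset : {m : σ →₀ ℕ | m.degree = d} = (Finset.univ.finsuppAntidiag d : Finset (σ →₀ ℕ)) := by
    ext m
    simp [Finset.mem_finsuppAntidiag, Finsupp.degree_eq_sum]
  rw [homogeneousSubmodule_eq_finsupp_supported, hset]
  rw [show finrank R (AddMonoidAlgebra.supported R R _) = _ from
      finrank_eq_nat_card_basis (basisRestrictSupport R _), Nat.card_coe_set_eq,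
    Set.ncard_coe_finset, Finset.card_finsuppAntidiag_nat_eq_multichoose, Finset.card_univ]

/-- If `P` is a homogeneous prime ideal of `ℂ[x₀, …, x_n]` not containing the irrelevant
ideal, whose quotient has Krull dimension `k + 1` (so `P` defines an irreducible projective
variety of dimension `k`), then containing the corresponding variety is at least
`binom(d+k, k)` conditions on degree-`d` hypersurfaces: the degree-`d` piece `P_d` of `P`
has codimension at least `binom(d+k, k)` in the space of degree-`d` forms. -/
theorem subvariety_conditions
    (n k d : ℕ) (hn : 1 ≤ n)
    (P : Ideal (MvPolynomial (Fin (n + 1)) ℂ)) (hP : P.IsPrime)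
    (hhom : ∀ f ∈ P, ∀ i : ℕ, homogeneousComponent i f ∈ P)
    (hirr : ¬ (Ideal.span
      (Set.range (X : Fin (n + 1) → MvPolynomial (Fin (n + 1)) ℂ)) ≤ P))
    (hdim : ringKrullDim (MvPolynomial (Fin (n + 1)) ℂ ⧸ P) = (k + 1 : ℕ)) :
    finrank ℂ
        ↥((Submodule.restrictScalars ℂ P) ⊓ homogeneousSubmodule (Fin (n + 1)) ℂ d)
      + (d + k).choose k
    ≤ finrank ℂ ↥(homogeneousSubmodule (Fin (n + 1)) ℂ d) := by
  let π := Ideal.Quotient.mkₐ ℂ P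
  have hadjoin : Algebra.adjoin ℂ (Set.range fun i ↦ π (X i)) = ⊤ := by
    rw [Set.range_comp' π X, ← AlgHom.map_adjoin, adjoin_range_X, Algebra.map_top,
      AlgHom.range_eq_top]
    exact Ideal.Quotient.mkₐ_surjective ℂ P
  obtain ⟨e, he⟩ := exists_embedding_algebraicIndependent _ hadjoin hdim.ge
  have hπ (f : MvPolynomial (Fin (k + 1)) ℂ) (hf : rename e f ∈ P) : f = 0 := by
    have hcomp : π.comp (rename e) = aeval ((fun i ↦ π (X i)) ∘ e) := by ext; simp
    apply he.eq_zero_of_aeval_eq_zero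
    rw [← hcomp]
    exact Ideal.Quotient.eq_zero_iff_mem.mpr hf
  let ρ := (rename e : MvPolynomial (Fin (k + 1)) ℂ →ₐ[ℂ] MvPolynomial (Fin (n + 1)) ℂ).toLinearMap
  let H := homogeneousSubmodule (Fin (n + 1)) ℂ d
  have hfin : Module.Finite ℂ H := Module.Finite.iff_fg.mpr (homogeneousSubmodule_fg _ _ d)
  let W := (homogeneousSubmodule (Fin (k + 1)) ℂ d).map ρ
  have hWH : W ≤ H := by
    rintro _ ⟨f, hf, rfl⟩
    exact IsHomogeneous.rename_isHomogeneous hf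
  have hW : finrank ℂ W = (d + k).choose k := by
    rw [← (Submodule.equivMapOfInjective ρ (rename_injective e e.injective) _).finrank_eq,
      finrank_homogeneousSubmodule,
      Nat.multichoose_eq, Fintype.card_fin, ← Nat.choose_symm_add]
    congr 1
    omega
  have hdisj : Disjoint (Submodule.restrictScalars ℂ P ⊓ H) W := by
    rw [Submodule.disjoint_def]
    rintro _ ⟨hfP, -⟩ ⟨f, -, rfl⟩
    rw [hπ f hfP, map_zero]
  rw [← hW]
  have hPfin : Module.Finite ℂ ↥(Submodule.restrictScalars ℂ P ⊓ H) :=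
    Submodule.finiteDimensional_of_le inf_le_right
  have hWfin : Module.Finite ℂ W := Submodule.finiteDimensional_of_le hWH
  have hsum := Submodule.finrank_sup_add_finrank_inf_eq (Submodule.restrictScalars ℂ P ⊓ H) W
  rw [hdisj.eq_bot, finrank_bot, add_zero] at hsum
  exact hsum.symm.trans_le (Submodule.finrank_mono (sup_le inf_le_right hWH))
end

section
/- Let n ≥ 2 and d ≥ n. Then a general degree-d hypersurface X ⊂ ℙⁿ has at most n − 1 lines through each of its points. Precisely: there exists a nonzero polynomial function G on the finite-dimensional ℂ-vector space of homogeneous degree-d polynomials in x₀, …, x_n (i.e., a nonzero polynomial in the coefficients) such that for every homogeneous f of degree d with G(f) ≠ 0 and for every nonzero p ∈ ℂ^{n+1} with f(p) = 0, the set of 2-dimensional linear subspaces W ⊆ ℂ^{n+1} with p ∈ W and f vanishing identically on W (equivalently, the set of lines in the hypersurface V(f) passing through the point [p]) has at most n − 1 elements. -/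
open MvPolynomial Module

/-- A polynomial map from a lower-dimensional affine space is not dominant. -/
theorem exists_ne_zero_aeval_eq_zero {σ τ : Type} [Fintype σ] [Fintype τ]
    (h : Fintype.card τ < Fintype.card σ) (φ : σ → MvPolynomial τ ℂ) :
    ∃ G : MvPolynomial σ ℂ, G ≠ 0 ∧ aeval φ G = 0 := by
  by_contra! H
  have hind : AlgebraicIndependent ℂ φ :=
    (injective_iff_map_eq_zero _).2 fun G hG => by_contra fun h0 => H G h0 hG
  have := hind.cardinalMk_le_trdeg
  rw [MvPolynomial.trdeg_of_isDomain] at this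
  simp at this
  omega

/-- A matrix with linearly independent rows has a nonvanishing maximal minor. -/
theorem exists_det_submatrix_ne_zero {σ ρ : Type} [Fintype σ] [Fintype ρ] [DecidableEq ρ]
    (A : Matrix ρ σ ℂ) (hA : LinearIndependent ℂ A.row) :
    ∃ J : ρ → σ, (A.submatrix id J).det ≠ 0 := by
  obtain ⟨κ, a, ha, hspan, hli⟩ := exists_linearIndependent' ℂ A.col
  have hrank := hA.rank_matrix
  rw [Matrix.rank_eq_finrank_span_cols, ← hspan] at hrank
  have : Fintype κ := Fintype.ofInjective a ha
  rw [finrank_span_eq_card hli] at hrank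
  let e : ρ ≃ κ := Fintype.equivOfCardEq hrank.symm
  refine ⟨a ∘ e, ?_⟩
  have h2 : LinearIndependent ℂ (A.submatrix id (a ∘ e)).col := hli.comp e e.injective
  rw [Matrix.linearIndependent_cols_iff_isUnit, Matrix.isUnit_iff_isUnit_det] at h2
  exact h2.ne_zero

/-- Vectors in the kernels of a family of matrices with polynomial entries, at parameters where a
given maximal minor is nonzero, satisfy a nontrivial polynomial relation if there are fewer
parameters than rows. -/
theorem exists_ne_zero_eval_eq_zero_of_minor {σ τ ρ : Type} [Fintype σ] [Fintype τ] [Fintype ρ]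
    [DecidableEq ρ]
    (h : Fintype.card τ < Fintype.card ρ) (A : Matrix ρ σ (MvPolynomial τ ℂ)) (J : ρ → σ)
    (hJ : Function.Injective J) :
    ∃ G : MvPolynomial σ ℂ, G ≠ 0 ∧ ∀ (x : τ → ℂ) (f : σ → ℂ),
      ((A.map (eval x)).submatrix id J).det ≠ 0 → (A.map (eval x)).mulVec f = 0 →
        eval f G = 0 := by
  classical
  let κ := {i // i ∉ Set.range J}
  let v : σ → MvPolynomial (τ ⊕ κ) ℂ := fun i => if hi : i ∉ Set.range J then X (Sum.inr ⟨i, hi⟩) else 0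
  let A' : Matrix ρ σ (MvPolynomial (τ ⊕ κ) ℂ) := A.map (rename Sum.inl)
  let φ : σ → MvPolynomial (τ ⊕ κ) ℂ := fun i =>
    (A'.submatrix id J).det * v i -
      ∑ r, if J r = i then ((A'.submatrix id J).adjugate.mulVec (A'.mulVec v)) r else 0
  have hcard : Fintype.card (τ ⊕ κ) < Fintype.card σ := by
    have h1 : Fintype.card {i // i ∈ Set.range J} = Fintype.card ρ :=
      (Fintype.card_congr (Equiv.ofInjective J hJ)).symm
    have h2 := Fintype.card_subtype_compl (fun i => i ∈ Set.range J)
    have h3 := Fintype.card_subtype_le (fun i => i ∈ Set.range J)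
    have h4 : Fintype.card κ = Fintype.card {i // ¬ i ∈ Set.range J} := rfl
    rw [Fintype.card_sum]
    omega
  obtain ⟨G, hG0, hG⟩ := exists_ne_zero_aeval_eq_zero hcard φ
  refine ⟨G, hG0, fun x f hdet hf => ?_⟩
  set M := (A.map (eval x)).submatrix id J with hM
  let y : τ ⊕ κ → ℂ := Sum.elim x fun i => f i / M.det
  have hA' : A'.map (eval y) = A.map (eval x) := by
    ext i j
    simp [A', eval_rename, y, Function.comp_def]
  have hM' : (A'.submatrix id J).map (eval y) = M := by
    rw [← Matrix.submatrix_map, hA']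
  have hdet' : eval y (A'.submatrix id J).det = M.det := by
    rw [RingHom.map_det, RingHom.mapMatrix_apply, hM']
  have hadj' : (A'.submatrix id J).adjugate.map (eval y) = M.adjugate := by
    rw [← RingHom.mapMatrix_apply, RingHom.map_adjugate, RingHom.mapMatrix_apply, hM']
  let g : σ → ℂ := fun i => if i ∉ Set.range J then f i else 0
  have hv : (eval y) ∘ v = M.det⁻¹ • g := by
    ext i
    by_cases hi : i ∈ Set.range J
    · simp only [Function.comp, v, g, hi, not_true, dite_false, if_false, Pi.smul_apply,
        smul_zero, map_zero]
    · simp only [Function.comp, v, g, hi, not_false_eq_true, dite_true, if_true, Pi.smul_apply,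
        smul_eq_mul, eval_X, y, Sum.elim_inr]
      field_simp
  have hg : (A.map (eval x)).mulVec g = - M.mulVec (f ∘ J) := by
    rw [eq_neg_iff_add_eq_zero, ← hf]
    ext r
    simp only [Pi.add_apply, Matrix.mulVec, dotProduct, hM, Matrix.submatrix_apply, id,
      Function.comp]
    rw [← Fintype.sum_subtype_add_sum_subtype (fun i => i ∈ Set.range J)
      (fun i => (A.map (eval x)) r i * f i), add_comm]
    congr 1
    · convert Fintype.sum_bijective (Set.rangeFactorization J) (Set.rangeFactorization_bijective.2 hJ)
        _ (fun i => (A.map (eval x)) r i * f i) fun _ => rfl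
        <;> rfl
    · rw [← Fintype.sum_subtype_add_sum_subtype (fun i => i ∈ Set.range J)]
      rw [Finset.sum_eq_zero, zero_add]
      · exact Finset.sum_congr rfl fun i _ => by simp only [g]; rw [if_pos i.2]
      · intro i _
        simp only [g]
        rw [if_neg (not_not.2 i.2), mul_zero]
  have hφ : (fun i => eval y (φ i)) = f := by
    have key : ∀ r, eval y (((A'.submatrix id J).adjugate.mulVec (A'.mulVec v)) r) = - f (J r) := by
      intro r
      rw [RingHom.map_mulVec, hadj']
      have : (eval y) ∘ (A'.mulVec v) = (A.map (eval x)).mulVec (M.det⁻¹ • g) := by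
        ext s
        simp only [Function.comp_apply]
        rw [RingHom.map_mulVec, hA', hv]
      rw [this, Matrix.mulVec_smul, hg, Matrix.mulVec_smul, Matrix.mulVec_neg,
        Matrix.mulVec_mulVec, Matrix.adjugate_mul, Matrix.smul_mulVec, Matrix.one_mulVec]
      simp [hdet]
    ext i
    have hvi : eval y (v i) = M.det⁻¹ * g i := congrFun hv i
    simp only [φ, map_sub, map_mul, map_sum, hdet', hvi]
    rw [mul_inv_cancel_left₀ hdet]
    have : ∀ r, eval y (if J r = i then ((A'.submatrix id J).adjugate.mulVec (A'.mulVec v)) r else 0)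
        = if J r = i then - f (J r) else 0 := by
      intro r
      split_ifs
      · exact key r
      · simp
    simp only [this]
    by_cases hi : i ∈ Set.range J
    · obtain ⟨r, rfl⟩ := hi
      simp [g, hJ.eq_iff]
    · have : ∀ r, J r ≠ i := fun r hr => hi ⟨r, hr⟩
      simp [g, this]
  have := congrArg (aeval y) hG
  rwa [comp_aeval_apply, map_zero, aeval_eq_eval, aeval_eq_eval, hφ] at this

/-- If there are fewer parameters than rows, the vectors lying in the kernel of a member with
linearly independent rows of a polynomial family of matrices are not Zariski dense. -/
theorem exists_ne_zero_eval_eq_zero_of_rows {σ τ ρ : Type} [Fintype σ] [Fintype τ] [Fintype ρ]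
    (h : Fintype.card τ < Fintype.card ρ) (A : Matrix ρ σ (MvPolynomial τ ℂ)) :
    ∃ G : MvPolynomial σ ℂ, G ≠ 0 ∧ ∀ (x : τ → ℂ) (f : σ → ℂ),
      LinearIndependent ℂ (A.map (eval x)).row → (A.map (eval x)).mulVec f = 0 →
        eval f G = 0 := by
  classical
  have H : ∀ J : ρ → σ, ∃ G : MvPolynomial σ ℂ, G ≠ 0 ∧ ∀ (x : τ → ℂ) (f : σ → ℂ),
      ((A.map (eval x)).submatrix id J).det ≠ 0 → (A.map (eval x)).mulVec f = 0 →
        eval f G = 0 := by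
    intro J
    by_cases hJ : Function.Injective J
    · exact exists_ne_zero_eval_eq_zero_of_minor h A J hJ
    · refine ⟨1, one_ne_zero, fun x f hdet _ => ?_⟩
      simp only [Function.Injective, not_forall] at hJ
      obtain ⟨a, b, hab, hne⟩ := hJ
      exact absurd (Matrix.det_zero_of_column_eq hne fun r => by simp [hab]) hdet
  choose G hG0 hG using H
  refine ⟨∏ J, G J, Finset.prod_ne_zero_iff.2 fun J _ => hG0 J, fun x f hx hf => ?_⟩
  obtain ⟨J, hJ⟩ := exists_det_submatrix_ne_zero _ hx
  rw [map_prod]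
  exact Finset.prod_eq_zero (Finset.mem_univ J) (hG J x f hJ hf)

/-- A linear functional is given by a linear form. -/
theorem exists_isHomogeneous_one_eval_eq {N : ℕ} (φ : (Fin N → ℂ) →ₗ[ℂ] ℂ) :
    ∃ g : MvPolynomial (Fin N) ℂ, g.IsHomogeneous 1 ∧ ∀ y, eval y g = φ y := by
  refine ⟨∑ i, C (φ (Pi.single i 1)) * X i, IsHomogeneous.sum _ _ _ fun i _ => ?_, fun y => ?_⟩
  · simpa using (isHomogeneous_C (Fin N) (φ (Pi.single i 1))).mul (isHomogeneous_X ℂ i)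
  · rw [φ.pi_apply_eq_sum_univ y]
    simp only [map_sum, map_mul, eval_C, eval_X, smul_eq_mul]
    refine Finset.sum_congr rfl fun i _ => ?_
    rw [mul_comm]
    congr 2
    ext j
    simp [Pi.single_apply, eq_comm]

/-- Linear forms separate vectors from subspaces. -/
theorem exists_linearForm_of_notMem {N : ℕ} {p : Submodule ℂ (Fin N → ℂ)} {v : Fin N → ℂ}
    (hv : v ∉ p) :
    ∃ g : MvPolynomial (Fin N) ℂ, g.IsHomogeneous 1 ∧ eval v g ≠ 0 ∧ ∀ y ∈ p, eval y g = 0 := by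
  obtain ⟨φ, hφv, hφp⟩ := Submodule.exists_le_ker_of_notMem hv
  obtain ⟨g, hg, hgφ⟩ := exists_isHomogeneous_one_eval_eq φ
  exact ⟨g, hg, by rwa [hgφ], fun y hy => by rw [hgφ]; exact hφp hy⟩

/-- Each member of a linearly independent family is separated from the other ones by a
linear form. -/
theorem exists_linearForm_of_linearIndependent {N : ℕ} {ι : Type} {v : ι → Fin N → ℂ}
    (hv : LinearIndependent ℂ v) (j : ι) :
    ∃ g : MvPolynomial (Fin N) ℂ, g.IsHomogeneous 1 ∧ eval (v j) g ≠ 0 ∧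
      ∀ j' ≠ j, eval (v j') g = 0 := by
  obtain ⟨g, hg, hgj, hg0⟩ := exists_linearForm_of_notMem
    (hv.notMem_span_image (s := {j}ᶜ) (x := j) (by simp))
  exact ⟨g, hg, hgj, fun j' hj' => hg0 _ (Submodule.subset_span ⟨j', hj', rfl⟩)⟩

/-- If `v` is linearly independent and `z` consists of `s` further vectors in its span, all these
vectors being pairwise nonproportional, then forms of any degree greater than `s` separate them. -/
theorem exists_form_separating {N s e : ℕ} {ι : Type} [Fintype ι] {v : ι → Fin N → ℂ}
    {z : Fin s → Fin N → ℂ} (hv : LinearIndependent ℂ v)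
    (hne : ∀ α β, α ≠ β → Sum.elim v z α ∉ Submodule.span ℂ {Sum.elim v z β})
    (a : Fin s → ι → ℂ) (b : Fin s → ι) (hab : ∀ l, a l (b l) ≠ 0)
    (hz : ∀ l, z l = ∑ j, a l j • v j) (he : s < e) (α : ι ⊕ Fin s) :
    ∃ g : MvPolynomial (Fin N) ℂ, g.IsHomogeneous e ∧ eval (Sum.elim v z α) g ≠ 0 ∧
      ∀ β ≠ α, eval (Sum.elim v z β) g = 0 := by
  classical
  choose h hh1 hhα hhβ using fun α β (hαβ : α ≠ β) => exists_linearForm_of_notMem (hne α β hαβ)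
  have hhβ' := fun α β hαβ => hhβ α β hαβ _ (Submodule.mem_span_singleton_self _)
  -- It suffices to treat all the points but `s` of them by one linear form.
  suffices H : ∃ ℓ : MvPolynomial (Fin N) ℂ, ℓ.IsHomogeneous 1 ∧ eval (Sum.elim v z α) ℓ ≠ 0 ∧
      ∃ c : Fin s → ι ⊕ Fin s, (∀ l, α ≠ c l) ∧
        ∀ β ≠ α, eval (Sum.elim v z β) ℓ = 0 ∨ ∃ l, c l = β by
    obtain ⟨ℓ, hℓ1, hℓα, c, hc, hcβ⟩ := H
    refine ⟨ℓ ^ (e - s) * ∏ l, h α (c l) (hc l), ?_, ?_, fun β hβ => ?_⟩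
    · have h1 := hℓ1.pow (e - s)
      have h2 := IsHomogeneous.prod Finset.univ (fun l => h α (c l) (hc l)) (fun _ => 1)
        fun l _ => hh1 _ _ _
      have h3 := h1.mul h2
      simp only [Finset.sum_const, Finset.card_univ, Fintype.card_fin, smul_eq_mul, mul_one,
        one_mul] at h3
      rwa [Nat.sub_add_cancel he.le] at h3
    · rw [map_mul, map_pow, map_prod]
      exact mul_ne_zero (pow_ne_zero _ hℓα) (Finset.prod_ne_zero_iff.2 fun l _ => hhα _ _ _)
    · rw [map_mul, map_pow, map_prod]
      obtain h0 | ⟨l, rfl⟩ := hcβ β hβ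
      · rw [h0, zero_pow (by omega), zero_mul]
      · rw [Finset.prod_eq_zero (Finset.mem_univ l) (hhβ' _ _ _), mul_zero]
  obtain j | l := α
  · obtain ⟨ℓ, hℓ1, hℓj, hℓ0⟩ := exists_linearForm_of_linearIndependent hv j
    refine ⟨ℓ, hℓ1, hℓj, Sum.inr, by simp, ?_⟩
    rintro (j' | l') hβ
    · exact Or.inl (hℓ0 j' (by simpa using hβ))
    · exact Or.inr ⟨l', rfl⟩
  · obtain ⟨φ, hφv, hφp⟩ := Submodule.exists_le_ker_of_notMem
      (hv.notMem_span_image (s := {b l}ᶜ) (x := b l) (by simp))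
    obtain ⟨ℓ, hℓ1, hℓφ⟩ := exists_isHomogeneous_one_eval_eq φ
    have hφ0 : ∀ j ≠ b l, φ (v j) = 0 := fun j hj =>
      hφp (Submodule.subset_span ⟨j, hj, rfl⟩)
    refine ⟨ℓ, hℓ1, ?_, fun l' => if l' = l then Sum.inl (b l) else Sum.inr l', ?_, ?_⟩
    · rw [Sum.elim_inr, hℓφ, hz, map_sum, Finset.sum_eq_single (b l)]
      · simpa using ⟨hab l, hφv⟩
      · intro j _ hj
        simp [hφ0 j hj]
      · simp
    · intro l'
      by_cases hl : l' = l
      · simp [hl]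
      · simpa [hl] using Ne.symm hl
    · rintro (j' | l') hβ
      · by_cases hj : j' = b l
        · exact Or.inr ⟨l, by simp [hj]⟩
        · exact Or.inl (by rw [Sum.elim_inl, hℓφ, hφ0 j' hj])
      · exact Or.inr ⟨l', if_neg (by simpa using hβ)⟩

/-- The coefficient of `T ^ e` in `f (p + T y)`. -/
noncomputable def lineCoeff {R ι : Type} [CommRing R] [Algebra ℂ R] (p y : ι → R) (e : ℕ) :
    MvPolynomial ι ℂ →ₗ[ℂ] R :=
  (Polynomial.lcoeff R e).restrictScalars ℂ ∘ₗ
    (aeval fun i => Polynomial.C (p i) + Polynomial.X * Polynomial.C (y i)).toLinearMap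

theorem lineCoeff_apply {R ι : Type} [CommRing R] [Algebra ℂ R] (p y : ι → R) (e : ℕ)
    (f : MvPolynomial ι ℂ) :
    lineCoeff p y e f =
      (aeval (fun i => Polynomial.C (p i) + Polynomial.X * Polynomial.C (y i)) f).coeff e :=
  rfl

theorem map_lineCoeff {R S ι : Type} [CommRing R] [Algebra ℂ R] [CommRing S] [Algebra ℂ S]
    (θ : R →ₐ[ℂ] S) (p y : ι → R) (e : ℕ) (f : MvPolynomial ι ℂ) :
    θ (lineCoeff p y e f) = lineCoeff (fun i => θ (p i)) (fun i => θ (y i)) e f := by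
  rw [lineCoeff_apply, lineCoeff_apply, ← Polynomial.coeff_mapAlgHom_apply, comp_aeval_apply]
  simp

theorem lineCoeff_eq_zero {ι : Type} {p y : ι → ℂ} {f : MvPolynomial ι ℂ}
    (h : ∀ t : ℂ, eval (p + t • y) f = 0) (e : ℕ) : lineCoeff p y e f = 0 := by
  have : aeval (fun i => Polynomial.C (p i) + Polynomial.X * Polynomial.C (y i)) f = 0 := by
    refine Polynomial.funext fun t => ?_
    rw [Polynomial.eval_zero, ← h t, ← Polynomial.coe_aeval_eq_eval, comp_aeval_apply,
      aeval_eq_eval]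
    congr 2
    ext i
    simp only [Pi.add_apply, Pi.smul_apply, smul_eq_mul, Polynomial.coe_aeval_eq_eval,
      Polynomial.eval_add, Polynomial.eval_mul, Polynomial.eval_C, Polynomial.eval_X]
  rw [lineCoeff_apply, this, Polynomial.coeff_zero]

theorem aeval_X_mul_C {N e : ℕ} {g : MvPolynomial (Fin N) ℂ} (hg : g.IsHomogeneous e)
    (y : Fin N → ℂ) :
    aeval (fun i => (Polynomial.X : Polynomial ℂ) * Polynomial.C (y i)) g =
      Polynomial.X ^ e * Polynomial.C (eval y g) := by
  rw [aeval_def, eval₂_eq, eval_eq, map_sum, Finset.mul_sum]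
  refine Finset.sum_congr rfl fun m hm => ?_
  simp only [mul_pow, Finset.prod_mul_distrib, Finset.prod_pow_eq_pow_sum]
  rw [← hg.degree_eq_sum_deg_support hm]
  simp only [map_mul, map_prod, map_pow, Polynomial.algebraMap_eq]
  ring

/-- A degree-`d` form whose restrictions to the lines through `(1, p)` are governed by a given form
of degree `e ≤ d` in the directions of these lines. -/
theorem exists_form_lineCoeff {N d e : ℕ} (k : Fin (N + 1)) (p : Fin N → ℂ) (hed : e ≤ d)
    {g : MvPolynomial (Fin N) ℂ} (hg : g.IsHomogeneous e) :
    ∃ f : MvPolynomial (Fin (N + 1)) ℂ, f.IsHomogeneous d ∧ ∀ (y : Fin N → ℂ) (e' : ℕ),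
      lineCoeff (k.insertNth (1 : ℂ) p : Fin (N + 1) → ℂ) (k.insertNth (0 : ℂ) y) e' f =
        if e' = e then eval y g else 0 := by
  refine ⟨X k ^ (d - e) * aeval (fun i => X (k.succAbove i) - C (p i) * X k) g, ?_,
    fun y e' => ?_⟩
  · have h1 : (X k ^ (d - e) : MvPolynomial (Fin (N + 1)) ℂ).IsHomogeneous (1 * (d - e)) :=
      (isHomogeneous_X ℂ k).pow _
    have h2 : (aeval (fun i => (X (k.succAbove i) - C (p i) * X k : MvPolynomial _ ℂ)) g).IsHomogeneous
        (1 * e) := by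
      refine hg.aeval _ fun i => (isHomogeneous_X ℂ _).sub ?_
      simpa using (isHomogeneous_C (Fin (N + 1)) (p i)).mul (isHomogeneous_X ℂ k)
    have := h1.mul h2
    rwa [one_mul, one_mul, Nat.sub_add_cancel hed] at this
  · rw [lineCoeff_apply, map_mul, map_pow, aeval_X, comp_aeval_apply]
    simp only [map_sub, map_mul, aeval_X, Fin.insertNth_apply_same, Fin.insertNth_apply_succAbove,
      map_one, map_zero, mul_zero, add_zero, one_pow, one_mul, mul_one, aeval_C,
      Polynomial.algebraMap_eq, add_sub_cancel_left]
    rw [aeval_X_mul_C hg, mul_comm, Polynomial.coeff_C_mul_X_pow]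

instance finite_monomials (N d : ℕ) : Finite {μ : Fin N →₀ ℕ // μ.degree = d} :=
  (Finsupp.finite_of_degree_eq d).to_subtype

noncomputable instance fintypeMonomials (N d : ℕ) : Fintype {μ : Fin N →₀ ℕ // μ.degree = d} :=
  Fintype.ofFinite _

theorem sum_coeff_smul_monomial {N d : ℕ} {f : MvPolynomial (Fin N) ℂ} (hf : f.IsHomogeneous d) :
    ∑ μ : {μ : Fin N →₀ ℕ // μ.degree = d}, coeff μ.1 f • monomial μ.1 (1 : ℂ) = f := by
  classical
  ext ν
  simp only [coeff_sum, coeff_smul, coeff_monomial, smul_eq_mul, mul_ite, mul_one, mul_zero]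
  by_cases hν : ν.degree = d
  · rw [Finset.sum_eq_single ⟨ν, hν⟩]
    · simp
    · intro μ _ hμ
      exact if_neg fun h => hμ (Subtype.ext h)
    · simp
  · rw [hf.coeff_eq_zero hν]
    refine Finset.sum_eq_zero fun μ _ => if_neg fun h => hν ?_
    rw [← h, μ.2]

/-- The parameters for a point and `r + 1 + s` directions spanning a space of dimension `r + 1`:
the affine coordinates of the point, those of `r + 1` basis directions, and the coefficients of
the remaining `s` directions in the basis. -/
abbrev ChartParam (m r s : ℕ) : Type := Fin (m + 1) ⊕ (Fin (r + 1) × Fin m) ⊕ (Fin s × Fin r)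

/-- The basis directions, normalized to have coordinate `1` at the places given by `c`. -/
def baseDir {R : Type} [CommRing R] {m r s : ℕ} (c : Fin (r + 1) → Fin (m + 1))
    (x : ChartParam m r s → R) (j : Fin (r + 1)) : Fin (m + 1) → R :=
  (c j).insertNth (1 : R) fun i => x (Sum.inr (Sum.inl (j, i)))

/-- The coefficients of the dependent directions, normalized to be `1` at the places given
by `b`. -/
def dirCoeff {R : Type} [CommRing R] {m r s : ℕ} (b : Fin s → Fin (r + 1))
    (x : ChartParam m r s → R) (l : Fin s) : Fin (r + 1) → R :=
  (b l).insertNth (1 : R) fun i => x (Sum.inr (Sum.inr (l, i)))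

/-- All the directions with given parameters. -/
def chartDir {R : Type} [CommRing R] {m r s : ℕ} (c : Fin (r + 1) → Fin (m + 1))
    (b : Fin s → Fin (r + 1)) (x : ChartParam m r s → R) :
    Fin (r + 1) ⊕ Fin s → Fin (m + 1) → R :=
  Sum.elim (baseDir c x) fun l => ∑ j, dirCoeff b x l j • baseDir c x j

theorem map_insertNth {R S : Type} (θ : R → S) {N : ℕ} (k : Fin (N + 1)) (a : R)
    (y : Fin N → R) (i : Fin (N + 1)) :
    θ ((k.insertNth a y : Fin (N + 1) → R) i) =
      (k.insertNth (θ a) (fun i => θ (y i)) : Fin (N + 1) → S) i := by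
  induction i using k.succAboveCases <;> simp

theorem map_chartDir {R S : Type} [CommRing R] [CommRing S] (θ : R →+* S) {m r s : ℕ}
    (c : Fin (r + 1) → Fin (m + 1)) (b : Fin s → Fin (r + 1)) (x : ChartParam m r s → R)
    (α : Fin (r + 1) ⊕ Fin s) (i : Fin (m + 1)) :
    θ (chartDir c b x α i) = chartDir c b (fun τ => θ (x τ)) α i := by
  have hbase : ∀ j i, θ (baseDir c x j i) = baseDir c (fun τ => θ (x τ)) j i := by
    intro j i
    rw [baseDir, map_insertNth θ, map_one, baseDir]
  have hcoeff : ∀ l j, θ (dirCoeff b x l j) = dirCoeff b (fun τ => θ (x τ)) l j := by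
    intro l j
    rw [dirCoeff, map_insertNth θ, map_one, dirCoeff]
  obtain j | l := α
  · exact hbase j i
  · simp [chartDir, hbase, hcoeff]

/-- The linear conditions imposed on a form by the lines: vanishing at the point, vanishing
to all orders along the lines in the basis directions, and to orders greater than `s` along the
other lines. -/
abbrev ChartRow (d r s : ℕ) : Type := Unit ⊕ (Fin d × Fin (r + 1)) ⊕ (Fin (d - s) × Fin s)

/-- The order along the line of a condition. -/
def ChartRow.order {d r s : ℕ} : ChartRow d r s → ℕ :=
  Sum.elim (fun _ => 0) (Sum.elim (fun q => q.1 + 1) fun q => q.1 + s + 1)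

/-- The direction of the line of a condition. -/
def ChartRow.dir {d r s : ℕ} : ChartRow d r s → Fin (r + 1) ⊕ Fin s :=
  Sum.elim (fun _ => Sum.inl 0) (Sum.elim (fun q => Sum.inl q.2) fun q => Sum.inr q.2)

theorem ChartRow.order_le {d r s : ℕ} (q : ChartRow d r s) : q.order ≤ d := by
  obtain _ | ⟨i, j⟩ | ⟨i, l⟩ := q <;> simp [ChartRow.order]; omega

theorem ChartRow.ext_order_dir {d r s : ℕ} {q q' : ChartRow d r s} (h : q.order = q'.order)
    (h' : q.dir = q'.dir) : q = q' := by
  obtain _ | ⟨i, j⟩ | ⟨i, l⟩ := q <;> obtain _ | ⟨i', j'⟩ | ⟨i', l'⟩ := q' <;>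
    simp_all [ChartRow.order, ChartRow.dir, Fin.ext_iff]

theorem card_chartParam_lt_card_chartRow {m r s d : ℕ} (hm : r + s = m) (hd : m + 1 ≤ d) :
    Fintype.card (ChartParam m r s) < Fintype.card (ChartRow d r s) := by
  obtain ⟨t, rfl⟩ := Nat.exists_eq_add_of_le hd
  subst hm
  have : r + s + 1 + t - s = r + 1 + t := by omega
  simp only [Fintype.card_sum, Fintype.card_prod, Fintype.card_fin, Fintype.card_unit, this]
  nlinarith [Nat.zero_le (t * r), Nat.zero_le (t * s)]

/-- The conditions on forms in the directions are independent. -/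
theorem exists_form_of_chartRow {m r s d : ℕ} (c : Fin (r + 1) → Fin (m + 1))
    (b : Fin s → Fin (r + 1)) (x : ChartParam m r s → ℂ)
    (hli : LinearIndependent ℂ (baseDir c x))
    (hne : ∀ α β, α ≠ β → chartDir c b x α ∉ Submodule.span ℂ {chartDir c b x β})
    (q : ChartRow d r s) :
    ∃ g : MvPolynomial (Fin (m + 1)) ℂ, g.IsHomogeneous q.order ∧
      eval (chartDir c b x q.dir) g ≠ 0 ∧
      ∀ q' ≠ q, q'.order = q.order → eval (chartDir c b x q'.dir) g = 0 := by
  by_cases hs : s < q.order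
  · obtain ⟨g, hg, hg1, hg0⟩ := exists_form_separating hli hne (dirCoeff b x) b
      (fun l => by simp [dirCoeff]) (fun l => rfl) hs q.dir
    exact ⟨g, hg, hg1, fun q' hq' ho => hg0 _ fun h => hq' (ChartRow.ext_order_dir ho h)⟩
  · obtain _ | ⟨i, j⟩ | ⟨i, l⟩ := q
    · refine ⟨1, isHomogeneous_one _ _, by simp, ?_⟩
      rintro (_ | ⟨i, j⟩ | ⟨i, l⟩) <;> simp [ChartRow.order]
    · obtain ⟨ℓ, hℓ, hℓj, hℓ0⟩ := exists_linearForm_of_linearIndependent hli j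
      refine ⟨ℓ ^ (i.1 + 1), by simpa [ChartRow.order] using hℓ.pow (i.1 + 1), ?_, ?_⟩
      · simpa [ChartRow.dir, chartDir] using fun h => absurd h hℓj
      · rintro (_ | ⟨i', j'⟩ | ⟨i', l'⟩) hq ho
        · simp [ChartRow.order] at ho
        · have hj : j' ≠ j := by
            rintro rfl
            exact hq (ChartRow.ext_order_dir ho rfl)
          simp [ChartRow.dir, chartDir, hℓ0 j' hj]
        · simp [ChartRow.order] at ho hs
          omega
    · simp [ChartRow.order] at hs

/-- Forms of degree `d` vanishing on lines with a common point in a given chart satisfy a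
nontrivial polynomial relation. -/
theorem exists_relation_of_chart {m r s d : ℕ} (hm : r + s = m) (hd : m + 1 ≤ d)
    (k : Fin (m + 2)) (c : Fin (r + 1) → Fin (m + 1)) (b : Fin s → Fin (r + 1)) :
    ∃ G : MvPolynomial {μ : Fin (m + 2) →₀ ℕ // μ.degree = d} ℂ, G ≠ 0 ∧
      ∀ f : MvPolynomial (Fin (m + 2)) ℂ, f.IsHomogeneous d → ∀ x : ChartParam m r s → ℂ,
        LinearIndependent ℂ (baseDir c x) →
        (∀ α β, α ≠ β → chartDir c b x α ∉ Submodule.span ℂ {chartDir c b x β}) →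
        (∀ α (t : ℂ), eval ((k.insertNth (1 : ℂ) (fun i => x (Sum.inl i)) : Fin (m + 2) → ℂ) +
          t • (k.insertNth (0 : ℂ) (chartDir c b x α) : Fin (m + 2) → ℂ)) f = 0) →
        eval (fun μ : {μ : Fin (m + 2) →₀ ℕ // μ.degree = d} => coeff μ.1 f) G = 0 := by
  let A : Matrix (ChartRow d r s) {μ : Fin (m + 2) →₀ ℕ // μ.degree = d}
      (MvPolynomial (ChartParam m r s) ℂ) := fun q μ =>
    lineCoeff (k.insertNth 1 (fun i => X (Sum.inl i)) : Fin (m + 2) → _)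
      (k.insertNth 0 (chartDir c b X q.dir)) q.order (monomial μ.1 1)
  obtain ⟨G, hG0, hG⟩ :=
    exists_ne_zero_eval_eq_zero_of_rows (card_chartParam_lt_card_chartRow hm hd) A
  refine ⟨G, hG0, fun f hf x hli hne hlines => ?_⟩
  let L : ChartRow d r s → MvPolynomial (Fin (m + 2)) ℂ →ₗ[ℂ] ℂ := fun q =>
    lineCoeff (k.insertNth (1 : ℂ) (fun i => x (Sum.inl i)) : Fin (m + 2) → ℂ)
      (k.insertNth (0 : ℂ) (chartDir c b x q.dir)) q.order
  have hA : ∀ q μ, (A.map (eval x)) q μ = L q (monomial μ.1 1) := by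
    intro q μ
    have h := map_lineCoeff (aeval x)
      (k.insertNth 1 (fun i => X (Sum.inl i)) : Fin (m + 2) → MvPolynomial (ChartParam m r s) ℂ)
      (k.insertNth 0 (chartDir c b X q.dir)) q.order (monomial μ.1 1)
    simp only [map_insertNth, map_one, map_zero, aeval_X] at h
    have h2 : ∀ i, aeval x (chartDir c b X q.dir i : MvPolynomial (ChartParam m r s) ℂ) =
        chartDir c b x q.dir i := by
      intro i
      simpa using map_chartDir (eval x) c b X q.dir i
    simp only [h2] at h
    exact h
  have hmul : ∀ f : MvPolynomial (Fin (m + 2)) ℂ, f.IsHomogeneous d →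
      (A.map (eval x)).mulVec (fun μ => coeff μ.1 f) = fun q => L q f := by
    intro f hf
    ext q
    conv_rhs => rw [← sum_coeff_smul_monomial hf]
    simp only [Matrix.mulVec, dotProduct, hA, map_sum, map_smul, smul_eq_mul, mul_comm]
  refine hG x _ ?_ ?_
  · rw [Fintype.linearIndependent_iff]
    intro w hw q
    obtain ⟨g, hg, hg1, hg0⟩ := exists_form_of_chartRow c b x hli hne q
    obtain ⟨F, hF, hFL⟩ := exists_form_lineCoeff k (fun i => x (Sum.inl i)) q.order_le hg
    have h1 : w ⬝ᵥ (A.map (eval x)).mulVec (fun μ => coeff μ.1 F) = 0 := by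
      rw [Matrix.dotProduct_mulVec, Matrix.vecMul_eq_sum]
      simp only [Matrix.row] at hw
      rw [hw, zero_dotProduct]
    rw [hmul F hF, dotProduct, Finset.sum_eq_single q] at h1
    · simp only [L, hFL, if_true] at h1
      exact (mul_eq_zero.1 h1).resolve_right hg1
    · intro q' _ hq'
      simp only [L, hFL]
      split_ifs with ho
      · rw [hg0 q' hq' ho, mul_zero]
      · rw [mul_zero]
    · simp
  · rw [hmul f hf]
    ext q
    exact lineCoeff_eq_zero (hlines q.dir) _

/-- A nonzero vector can be scaled to have some coordinate equal to `1`. -/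
theorem exists_insertNth_one_eq_smul {N : ℕ} {y : Fin (N + 1) → ℂ} (hy : y ≠ 0) :
    ∃ (k : Fin (N + 1)) (y' : Fin N → ℂ) (t : ℂ), t ≠ 0 ∧
      (k.insertNth (1 : ℂ) y' : Fin (N + 1) → ℂ) = t • y := by
  obtain ⟨k, hk⟩ := Function.ne_iff.1 hy
  have hk : y k ≠ 0 := hk
  refine ⟨k, fun i => (y k)⁻¹ * y (k.succAbove i), (y k)⁻¹, inv_ne_zero hk, ?_⟩
  ext i
  induction i using k.succAboveCases <;> simp [hk]

/-- A plane through a point in an affine chart is determined by a direction in the hyperplane at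
infinity. -/
theorem exists_direction {N : ℕ} {k : Fin (N + 1)} {p : Fin N → ℂ}
    {W : Submodule ℂ (Fin (N + 1) → ℂ)} (hW : finrank ℂ W = 2)
    (hp : (k.insertNth (1 : ℂ) p : Fin (N + 1) → ℂ) ∈ W) :
    ∃ u : Fin N → ℂ, u ≠ 0 ∧ (k.insertNth (0 : ℂ) u : Fin (N + 1) → ℂ) ∈ W ∧
      ∀ W' : Submodule ℂ (Fin (N + 1) → ℂ), finrank ℂ W' = 2 →
        (k.insertNth (1 : ℂ) p : Fin (N + 1) → ℂ) ∈ W' →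
        (k.insertNth (0 : ℂ) u : Fin (N + 1) → ℂ) ∈ W' → W' = W := by
  set P : Fin (N + 1) → ℂ := k.insertNth (1 : ℂ) p with hP
  have hPk : P k = 1 := by simp [hP]
  have hlt : ¬ W ≤ Submodule.span ℂ {P} := by
    intro h
    have := Submodule.finrank_mono h
    rw [finrank_span_singleton fun h0 : P = 0 => by simp [h0] at hPk] at this
    omega
  obtain ⟨w, hwW, hw⟩ := SetLike.not_le_iff_exists.1 hlt
  have hu : (k.insertNth (0 : ℂ) (fun i => (w - w k • P) (k.succAbove i)) : Fin (N + 1) → ℂ) =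
      w - w k • P := by
    ext i
    induction i using k.succAboveCases <;> simp [hPk]
  have hne : w - w k • P ≠ 0 := fun h0 =>
    hw (Submodule.mem_span_singleton.2 ⟨w k, (sub_eq_zero.1 h0).symm⟩)
  refine ⟨fun i => (w - w k • P) (k.succAbove i), fun h0 => hne ?_, ?_, ?_⟩
  · rw [← hu, h0]
    ext i
    induction i using k.succAboveCases <;> simp
  · rw [hu]
    exact W.sub_mem hwW (W.smul_mem _ hp)
  · intro W' hW' hP' hu'
    rw [hu] at hu'
    have hli : LinearIndependent ℂ ![P, w - w k • P] := by
      rw [LinearIndependent.pair_iff]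
      intro s t hst
      have hs : s = 0 := by simpa [hPk] using congrFun hst k
      rw [hs, zero_smul, zero_add] at hst
      exact ⟨hs, (smul_eq_zero.1 hst).resolve_right hne⟩
    have hspan : ∀ V : Submodule ℂ (Fin (N + 1) → ℂ), finrank ℂ V = 2 → P ∈ V →
        w - w k • P ∈ V → Submodule.span ℂ (Set.range ![P, w - w k • P]) = V := by
      intro V hV h1 h2
      refine Submodule.eq_of_le_of_finrank_eq ?_ ?_
      · rw [Submodule.span_le]
        rintro _ ⟨i, rfl⟩
        fin_cases i
        exacts [h1, h2]
      · rw [finrank_span_eq_card hli, hV, Fintype.card_fin]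
    rw [← hspan W' hW' hP' hu', hspan W hW hp (W.sub_mem hwW (W.smul_mem _ hp))]

/-- A nonzero family of vectors splits into a basis of its span and the remaining vectors. -/
theorem exists_equiv_linearIndependent {E : Type} [AddCommGroup E] [Module ℂ E] {m : ℕ}
    {u : Fin (m + 1) → E} (hu : u 0 ≠ 0) :
    ∃ r s : ℕ, r + s = m ∧ ∃ ε : Fin (r + 1) ⊕ Fin s ≃ Fin (m + 1),
      LinearIndependent ℂ (fun j => u (ε (Sum.inl j))) ∧
      ∀ l, u (ε (Sum.inr l)) ∈ Submodule.span ℂ (Set.range fun j => u (ε (Sum.inl j))) := by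
  classical
  obtain ⟨κ, a, ha, hspan, hli⟩ := exists_linearIndependent' ℂ u
  have : Fintype κ := Fintype.ofInjective a ha
  have hκ : Nonempty κ := by
    by_contra h
    rw [not_nonempty_iff] at h
    rw [Set.range_eq_empty, Submodule.span_empty] at hspan
    have : u 0 ∈ Submodule.span ℂ (Set.range u) := Submodule.subset_span ⟨0, rfl⟩
    rw [← hspan, Submodule.mem_bot] at this
    exact hu this
  obtain ⟨r, hr⟩ := Nat.exists_eq_succ_of_ne_zero (Fintype.card_ne_zero (α := κ))
  let e₁ : Fin (r + 1) ≃ Set.range a :=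
    (Fintype.equivFinOfCardEq hr).symm.trans (Equiv.ofInjective a ha)
  let e₂ := (Fintype.equivFin ((Set.range a)ᶜ : Set (Fin (m + 1)))).symm
  let ε := (Equiv.sumCongr e₁ e₂).trans (Equiv.Set.sumCompl (Set.range a))
  have hinl : (fun j => u (ε (Sum.inl j))) = (u ∘ a) ∘ (Fintype.equivFinOfCardEq hr).symm := by
    ext j
    simp [ε, e₁]
  refine ⟨r, _, ?_, ε, ?_, ?_⟩
  · have := Fintype.card_congr ε
    simp only [Fintype.card_sum, Fintype.card_fin] at this ⊢
    omega
  · rw [hinl]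
    exact hli.comp _ (Equiv.injective _)
  · intro l
    rw [hinl, Set.range_comp (u ∘ a), Equiv.range_eq_univ, Set.image_univ, hspan]
    exact Submodule.subset_span ⟨_, rfl⟩

/-- Pairwise nonproportional directions are, up to scaling, given by parameters in some chart. -/
theorem exists_chartDir_eq_smul {m : ℕ} {u : Fin (m + 1) → Fin (m + 1) → ℂ} (hu : ∀ i, u i ≠ 0)
    (p : Fin (m + 1) → ℂ) :
    ∃ r s : ℕ, r + s = m ∧ ∃ (ε : Fin (r + 1) ⊕ Fin s ≃ Fin (m + 1))
      (c : Fin (r + 1) → Fin (m + 1)) (b : Fin s → Fin (r + 1)) (x : ChartParam m r s → ℂ),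
      (∀ i, x (Sum.inl i) = p i) ∧ LinearIndependent ℂ (baseDir c x) ∧
      ∀ α, ∃ t : ℂ, t ≠ 0 ∧ chartDir c b x α = t • u (ε α) := by
  obtain ⟨r, s, hrs, ε, hli, hmem⟩ := exists_equiv_linearIndependent (hu 0)
  choose c v t ht hv using fun j => exists_insertNth_one_eq_smul (hu (ε (Sum.inl j)))
  have hv' : ∀ l, ∃ a : Fin (r + 1) → ℂ, u (ε (Sum.inr l)) =
      ∑ j, a j • ((c j).insertNth (1 : ℂ) (v j) : Fin (m + 1) → ℂ) := by
    intro l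
    obtain ⟨a, ha⟩ := (Submodule.mem_span_range_iff_exists_fun ℂ).1 (hmem l)
    refine ⟨fun j => a j * (t j)⁻¹, ?_⟩
    rw [← ha]
    refine Finset.sum_congr rfl fun j _ => ?_
    rw [hv, smul_smul, inv_mul_cancel_right₀ (ht j)]
  choose a ha using hv'
  have ha0 : ∀ l, a l ≠ 0 := by
    intro l h0
    refine hu (ε (Sum.inr l)) ?_
    rw [ha, h0]
    simp
  choose b a' t' ht' ha' using fun l => exists_insertNth_one_eq_smul (ha0 l)
  let x : ChartParam m r s → ℂ := Sum.elim p (Sum.elim (fun q => v q.1 q.2) fun q => a' q.1 q.2)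
  have hbase : ∀ j, baseDir c x j = t j • u (ε (Sum.inl j)) := hv
  have hcoeff : ∀ l, dirCoeff b x l = t' l • a l := ha'
  refine ⟨r, s, hrs, ε, c, b, x, fun i => rfl, ?_, ?_⟩
  · rw [show baseDir c x = (fun j => Units.mk0 (t j) (ht j)) • fun j => u (ε (Sum.inl j)) from
      funext hbase]
    exact hli.units_smul _
  · rintro (j | l)
    · exact ⟨t j, ht j, hbase j⟩
    · refine ⟨t' l, ht' l, ?_⟩
      rw [ha, Finset.smul_sum]
      simp only [chartDir, Sum.elim_inr, hcoeff, Pi.smul_apply, smul_assoc]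
      rfl

/-- A general form of degree `d > m` does not vanish on `m + 1` distinct planes with a common
nonzero vector. -/
theorem exists_relation_of_planes {m d : ℕ} (hd : m + 1 ≤ d) :
    ∃ G : MvPolynomial {μ : Fin (m + 2) →₀ ℕ // μ.degree = d} ℂ, G ≠ 0 ∧
      ∀ f : MvPolynomial (Fin (m + 2)) ℂ, f.IsHomogeneous d →
        ∀ p : Fin (m + 2) → ℂ, p ≠ 0 →
          ∀ W : Fin (m + 1) → Submodule ℂ (Fin (m + 2) → ℂ), Function.Injective W →
            (∀ i, finrank ℂ (W i) = 2 ∧ p ∈ W i ∧ ∀ w ∈ W i, eval w f = 0) →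
            eval (fun μ : {μ : Fin (m + 2) →₀ ℕ // μ.degree = d} => coeff μ.1 f) G = 0 := by
  classical
  choose G hG0 hG using fun q : (r : Fin (m + 1)) × Fin (m + 2) ×
      (Fin (r.1 + 1) → Fin (m + 1)) × (Fin (m - r.1) → Fin (r.1 + 1)) =>
    exists_relation_of_chart (m := m) (r := q.1.1) (s := m - q.1.1) (d := d) (by omega) hd
      q.2.1 q.2.2.1 q.2.2.2
  refine ⟨∏ q, G q, Finset.prod_ne_zero_iff.2 fun q _ => hG0 q, fun f hf p hp W hWinj hW => ?_⟩
  obtain ⟨k, p', t, ht, hp'⟩ := exists_insertNth_one_eq_smul hp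
  have hpW : ∀ i, (k.insertNth (1 : ℂ) p' : Fin (m + 2) → ℂ) ∈ W i := fun i => by
    rw [hp']
    exact (W i).smul_mem _ (hW i).2.1
  choose u hu0 huW huniq using fun i => exists_direction (hW i).1 (hpW i)
  obtain ⟨r, s, hrs, ε, c, b, x, hxp, hli, hdir⟩ := exists_chartDir_eq_smul hu0 p'
  obtain rfl : s = m - r := by omega
  rw [map_prod]
  refine Finset.prod_eq_zero (Finset.mem_univ ⟨⟨r, by omega⟩, k, c, b⟩)
    (hG ⟨⟨r, by omega⟩, k, c, b⟩ f hf x hli ?_ ?_)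
  · intro α β hαβ hmem
    obtain ⟨a, ha0, ha⟩ := hdir α
    obtain ⟨a', -, ha'⟩ := hdir β
    obtain ⟨z, hz⟩ := Submodule.mem_span_singleton.1 hmem
    have hprop : u (ε α) = (a⁻¹ * (z * a')) • u (ε β) := by
      rw [mul_smul, mul_smul, ← ha', hz, ha, smul_smul, inv_mul_cancel₀ ha0, one_smul]
    refine hαβ (ε.injective (hWinj (huniq (ε α) (W (ε β)) (hW _).1 (hpW _) ?_).symm))
    have : (k.insertNth (0 : ℂ) (u (ε α)) : Fin (m + 2) → ℂ) =
        (a⁻¹ * (z * a')) • (k.insertNth (0 : ℂ) (u (ε β)) : Fin (m + 2) → ℂ) := by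
      rw [hprop]
      ext i
      induction i using k.succAboveCases <;> simp
    rw [this]
    exact (W (ε β)).smul_mem _ (huW _)
  · intro α y
    obtain ⟨a, -, ha⟩ := hdir α
    refine (hW (ε α)).2.2 _ (Submodule.add_mem _ ?_ (Submodule.smul_mem _ _ ?_))
    · simp only [hxp]
      exact hpW _
    · have : (k.insertNth (0 : ℂ) (chartDir c b x α) : Fin (m + 2) → ℂ) =
          a • (k.insertNth (0 : ℂ) (u (ε α)) : Fin (m + 2) → ℂ) := by
        rw [ha]
        ext i
        induction i using k.succAboveCases <;> simp
      rw [this]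
      exact Submodule.smul_mem _ _ (huW _)


/-- For `d ≥ n ≥ 2`, a general degree-`d` hypersurface `X ⊂ ℙⁿ` has at most `n - 1`
lines through each of its points: there is a polynomial `G` in the coefficients,
not identically zero on the space of homogeneous degree-`d` polynomials, such that for
every homogeneous `f` of degree `d` with `G(coeffs of f) ≠ 0` and every nonzero point
`p` of `V(f)`, the set of 2-dimensional subspaces `W ⊆ ℂ^{n+1}` with `p ∈ W` and `f`
vanishing on `W` has at most `n - 1` elements. -/
theorem general_hypersurface_few_lines_through_point
    (n d : ℕ) (hn : 2 ≤ n) (hd : n ≤ d) :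
    ∃ G : MvPolynomial (Fin (n + 1) →₀ ℕ) ℂ,
      (∃ f0 ∈ homogeneousSubmodule (Fin (n + 1)) ℂ d,
        eval (fun m => coeff m f0) G ≠ 0) ∧
      ∀ f ∈ homogeneousSubmodule (Fin (n + 1)) ℂ d,
        eval (fun m => coeff m f) G ≠ 0 →
        ∀ p : Fin (n + 1) → ℂ, p ≠ 0 → eval p f = 0 →
          {W : Submodule ℂ (Fin (n + 1) → ℂ) |
              finrank ℂ ↥W = 2 ∧ p ∈ W ∧ ∀ w ∈ W, eval w f = 0}.Finite ∧
          {W : Submodule ℂ (Fin (n + 1) → ℂ) |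
              finrank ℂ ↥W = 2 ∧ p ∈ W ∧ ∀ w ∈ W, eval w f = 0}.ncard ≤ n - 1 := by

  obtain ⟨m, rfl⟩ : ∃ m, n = m + 1 := ⟨n - 1, by omega⟩
  obtain ⟨G, hG0, hG⟩ := exists_relation_of_planes hd
  refine ⟨rename Subtype.val G, ?_, fun f hf hGf p hp _ => ?_⟩
  · obtain ⟨w, hw⟩ : ∃ w, eval w G ≠ 0 := by
      by_contra! h
      exact hG0 (MvPolynomial.funext fun w => by rw [h, map_zero])
    refine ⟨∑ μ, w μ • monomial μ.1 1, ?_, ?_⟩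
    · exact Submodule.sum_mem _ fun μ _ => Submodule.smul_mem _ _ <|
        (mem_homogeneousSubmodule _ _).2 (isHomogeneous_monomial 1 μ.2)
    · rw [eval_rename]
      convert hw
      ext ν
      classical
      simp [coeff_sum, coeff_monomial, Subtype.val_inj]
  · rw [Nat.add_sub_cancel, ← Set.encard_le_coe_iff_finite_ncard_le]
    by_contra hlt
    obtain ⟨t, htS, ht⟩ := Set.exists_subset_encard_eq (Order.add_one_le_of_lt (not_le.1 hlt))
    have hfin : t.Finite := Set.finite_of_encard_eq_coe (k := m + 1) (by simpa using ht)
    have hcard : Nat.card t = m + 1 := by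
      rw [Nat.card_coe_set_eq, Set.ncard_def, ht]
      rfl
    have := hfin.to_subtype
    let e := (Finite.equivFinOfCardEq hcard).symm
    refine hGf ?_
    rw [eval_rename]
    exact hG f ((mem_homogeneousSubmodule _ _).1 hf) p hp (fun i => (e i).1)
      (Subtype.val_injective.comp e.injective) fun i => htS (e i).2
end
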